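/- In every execution of Algorithm A_k in which both processes decide, the outputs satisfy |y_1 − y_2| ≤ 1/(2k+1). -/

import Mathlib

/-!
Operational semantics of the two-process 1-bit-register approximate-agreement
protocol `A_k` (Algorithm 1 of the paper).

The two processes are indexed by `Fin 2`.  Shared memory consists of two 1-bit
registers `R 0, R 1` (initialized to `false`, i.e. `0`; only process `i` writes
`R i`) and two write-once input registers `I 0, I 1` (initialized to `⊥ = none`).
Each read or write of a single register is one atomic step.  An execution is
determined by the inputs `x : Fin 2 → Bool` together with a schedule
`sched : ℕ → Fin 2` telling which process takes the next step (a step of a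
process that has already decided is a no-op; a process crashes by being
scheduled only finitely often).
-/

namespace AlgoAk

/-- The other process. -/
def other (i : Fin 2) : Fin 2 := if i = 0 then 1 else 0

/-- The value (0 or 1) as a rational. -/
def bq (b : Bool) : ℚ := if b then 1 else 0

/-- Program counter of a process:
`start` = about to write its input to its input register;
`loopW` = about to perform the write of the current for-loop iteration;
`loopR` = about to perform the read of the current for-loop iteration;
`readMine` = left the for-loop, about to read its own input register;
`readOther` = about to read the other input register (and then decide);
`done` = has decided. -/
inductive PC where
  | start | loopW | loopR | readMine | readOther | done
deriving DecidableEq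

/-- Local state of a process: program counter, loop variable `r`, local
variables `prec` and `new`, the value read from the other input register,
and the output (once decided). -/
structure PState where
  pc : PC
  r : ℕ
  prec : Bool
  new : Bool
  xother : Option Bool
  out : Option ℚ

/-- Global configuration: local states, the two 1-bit registers, and the two
write-once input registers. -/
structure Config where
  p : Fin 2 → PState
  R : Fin 2 → Bool
  I : Fin 2 → Option Bool

/-- Initial local state. -/
def initP : PState := ⟨PC.start, 1, false, false, none, none⟩

/-- Initial configuration. -/
def initC : Config := ⟨fun _ => initP, fun _ => false, fun _ => none⟩

/-- Update the local state of process `i`. -/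
def updP (c : Config) (i : Fin 2) (s : PState) : Config :=
  { c with p := Function.update c.p i s }

/-- The decision function of the protocol, computed from the process' own input
`xme`, the value `xother` read from the other input register, and the values
`r` and `new` of the local variables when the for-loop was left. -/
def decideVal (k : ℕ) (xme : Bool) (xother : Option Bool) (r : ℕ) (new : Bool) : ℚ :=
  match xother with
  | none => bq xme
  | some xo =>
    if xme = xo then bq xme
    else if r = k ∧ new = decide (k % 2 = 1) then
      -- normal termination after k iterations
      let xwho := if r % 2 = 0 then xme else xo
      (bq xwho + (k : ℚ)) / (2 * (k : ℚ) + 1)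
    else
      -- left the loop via a break at iteration r
      let xwho := if r % 2 = 0 then xo else xme
      bq xwho + ((-1 : ℚ) ^ (if xwho then 1 else 0) * ((r : ℚ) - 1)) / (2 * (k : ℚ) + 1)

/-- One atomic step of process `i` in configuration `c`. -/
def step (k : ℕ) (x : Fin 2 → Bool) (c : Config) (i : Fin 2) : Config :=
  let s := c.p i
  match s.pc with
  | PC.start =>
      let c' := updP c i { s with pc := PC.loopW }
      { c' with I := Function.update c'.I i (some (x i)) }
  | PC.loopW =>
      let c' := updP c i { s with pc := PC.loopR }
      { c' with R := Function.update c'.R i (decide (s.r % 2 = 1)) }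
  | PC.loopR =>
      let nv := c.R (other i)
      if nv ≠ s.prec then
        if s.r < k then
          updP c i { s with pc := PC.loopW, r := s.r + 1, prec := nv, new := nv }
        else
          updP c i { s with pc := PC.readMine, prec := nv, new := nv }
      else
        updP c i { s with pc := PC.readMine, new := nv }
  | PC.readMine =>
      updP c i { s with pc := PC.readOther }
  | PC.readOther =>
      let xo := c.I (other i)
      updP c i { s with pc := PC.done, xother := xo,
                        out := some (decideVal k (x i) xo s.r s.new) }
  | PC.done => c

/-- The configuration after `n` steps of the execution of `A_k` with inputs `x`
and schedule `sched`. -/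
def run (k : ℕ) (x : Fin 2 → Bool) (sched : ℕ → Fin 2) : ℕ → Config
  | 0 => initC
  | n + 1 => step k x (run k x sched n) (sched n)

end AlgoAk

namespace AlgoAk

/-- The number of writes to its register that a process has performed. -/
def PState.writes (s : PState) : ℕ :=
  if s.pc = PC.start ∨ s.pc = PC.loopW then s.r - 1 else s.r

/-- The process has left the for-loop. -/
def PState.Left (s : PState) : Prop :=
  s.pc = PC.readMine ∨ s.pc = PC.readOther ∨ s.pc = PC.done

/-- The process has left the for-loop by a break. -/
def PState.Broken (s : PState) : Prop :=
  s.Left ∧ s.new ≠ decide (s.r % 2 = 1)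

/-- The process has left the for-loop by normal termination. -/
def PState.Completed (s : PState) : Prop :=
  s.Left ∧ s.new = decide (s.r % 2 = 1)

/-- The invariant relating the local state of a process to its register `R`, its input register
`I`, its input `xme` and the input `xo` of the other process. -/
structure LocalInv (k : ℕ) (xme xo : Bool) (s : PState) (R : Bool) (I : Option Bool) : Prop where
  one_le : 1 ≤ s.r
  le : s.r ≤ k
  start : s.pc = PC.start → s.r = 1 ∧ I = none
  input : s.pc ≠ PC.start → I = some xme
  reg : R = decide (s.writes % 2 = 1)
  prec : ¬ s.Left → s.prec = decide (s.r % 2 = 0)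
  completed : s.Completed → s.r = k
  out_none : s.pc ≠ PC.done → s.out = none
  out_done : s.pc = PC.done → s.out = some (decideVal k xme (some xo) s.r s.new)

/-- `t` has performed exactly one write more than `s`. -/
structure Ahead (s t : PState) : Prop where
  writes : t.writes = s.writes + 1
  not_completed : ¬ s.Completed
  pending : t.pc = PC.loopR ∨ t.Broken

lemma ahead_iff (s t : PState) : Ahead s t ↔
    t.writes = s.writes + 1 ∧ ¬ s.Completed ∧ (t.pc = PC.loopR ∨ t.Broken) :=
  ⟨fun ⟨h₁, h₂, h₃⟩ => ⟨h₁, h₂, h₃⟩, fun ⟨h₁, h₂, h₃⟩ => ⟨h₁, h₂, h₃⟩⟩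

/-- The relation between the local states of the two processes in a reachable configuration. -/
def Compatible (s t : PState) : Prop :=
  (s.writes = t.writes ∧ ¬ (s.Broken ∧ t.Broken)) ∨ Ahead s t ∨ Ahead t s

lemma Compatible.symm {s t : PState} (h : Compatible s t) : Compatible t s := by
  rcases h with ⟨h, hb⟩ | h | h
  · exact .inl ⟨h.symm, fun hb' => hb hb'.symm⟩
  · exact .inr (.inr h)
  · exact .inr (.inl h)

/-- The invariant of all reachable configurations. -/
structure Inv (k : ℕ) (x : Fin 2 → Bool) (c : Config) : Prop where
  loc : ∀ i, LocalInv k (x i) (x (other i)) (c.p i) (c.R i) (c.I i)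
  compatible : ∀ i, Compatible (c.p i) (c.p (other i))

lemma other_ne (i : Fin 2) : other i ≠ i := by
  fin_cases i <;> decide

lemma other_other (i : Fin 2) : other (other i) = i := by
  fin_cases i <;> rfl

lemma eq_or_eq_other (i j : Fin 2) : j = i ∨ j = other i := by
  fin_cases i <;> fin_cases j <;> decide

/-- To establish the invariant after a step of process `i`, it suffices to look at `i`. -/
lemma Inv.of_changes_at {k : ℕ} {x : Fin 2 → Bool} {c c' : Config} (h : Inv k x c) (i : Fin 2)
    (hp : c'.p (other i) = c.p (other i)) (hR : c'.R (other i) = c.R (other i))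
    (hI : c'.I (other i) = c.I (other i))
    (hloc : LocalInv k (x i) (x (other i)) (c'.p i) (c'.R i) (c'.I i))
    (hcomp : Compatible (c'.p i) (c.p (other i))) : Inv k x c' := by
  refine ⟨fun j => ?_, fun j => ?_⟩
  · rcases eq_or_eq_other i j with rfl | rfl
    · exact hloc
    · rw [hp, hR, hI]
      exact h.loc _
  · rcases eq_or_eq_other i j with rfl | rfl
    · rwa [hp]
    · rw [other_other, hp]
      exact hcomp.symm

lemma decideVal_none (k : ℕ) (a b : Bool) :
    decideVal k a none 1 false = decideVal k a (some b) 1 false := by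
  by_cases hk : 1 = k
  · subst hk
    simp [decideVal]
  · simp [decideVal, hk]

lemma inv_initC {k : ℕ} (hk : 1 ≤ k) (x : Fin 2 → Bool) : Inv k x initC := by
  refine ⟨fun i => ?_, fun i => .inl ?_⟩
  · constructor <;> simp [initC, initP, PState.writes, PState.Left, PState.Completed, hk]
  · simp [initC, initP, PState.Broken, PState.Left]

lemma Inv.step {k : ℕ} {x : Fin 2 → Bool} {c : Config} (h : Inv k x c) (i : Fin 2) :
    Inv k x (step k x c i) := by
  have hne := other_ne i
  have hi := h.loc i
  have hj := h.loc (other i)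
  have hc := h.compatible i
  obtain ⟨i1, i2, i3, i4, i5, i6, i7, i8, i9⟩ := hi
  obtain ⟨j1, j2, j3, j4, j5, j6, j7, j8, j9⟩ := hj
  generalize hs : c.p i = s at *
  generalize ht : c.p (other i) = t at *
  obtain ⟨pc, r, prec, new, xother, out⟩ := s
  cases pc with
  | start | loopW | readMine =>
    apply h.of_changes_at i <;> simp [AlgoAk.step, hs, ht, updP, hne]
    · constructor <;> grind [PState.writes, PState.Left, PState.Completed]
    · simp only [Compatible, ahead_iff] at *
      grind [PState.writes, PState.Left, PState.Completed, PState.Broken]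
  | loopR =>
    by_cases hn : c.R (other i) = prec
    · apply h.of_changes_at i <;> simp [AlgoAk.step, hs, ht, updP, hne, hn]
      · constructor <;> grind [PState.writes, PState.Left, PState.Completed]
      · simp only [Compatible, ahead_iff] at *
        grind [PState.writes, PState.Left, PState.Completed, PState.Broken]
    · by_cases hr : r < k
      · apply h.of_changes_at i <;> simp [AlgoAk.step, hs, ht, updP, hne, hn, hr]
        · constructor <;> grind [PState.writes, PState.Left, PState.Completed]
        · simp only [Compatible, ahead_iff] at *
          grind [PState.writes, PState.Left, PState.Completed, PState.Broken]
      · apply h.of_changes_at i <;> simp [AlgoAk.step, hs, ht, updP, hne, hn, hr]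
        · constructor <;> grind [PState.writes, PState.Left, PState.Completed]
        · simp only [Compatible, ahead_iff] at *
          grind [PState.writes, PState.Left, PState.Completed, PState.Broken]
  | readOther =>
    apply h.of_changes_at i <;> simp [AlgoAk.step, hs, ht, updP, hne]
    · have hval : decideVal k (x i) (c.I (other i)) r new =
          decideVal k (x i) (some (x (other i))) r new := by
        by_cases hpc : t.pc = PC.start
        · have hr : r = 1 ∧ new = false := by
            simp only [Compatible, ahead_iff] at hc
            grind [PState.writes, PState.Left, PState.Completed, PState.Broken]
          rw [(j3 hpc).2, hr.1, hr.2]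
          exact decideVal_none ..
        · rw [j4 hpc]
      constructor <;> grind [PState.writes, PState.Left, PState.Completed]
    · simp only [Compatible, ahead_iff] at *
      grind [PState.writes, PState.Left, PState.Completed, PState.Broken]
  | done =>
    simpa [AlgoAk.step, hs] using h

lemma inv_run {k : ℕ} (hk : 1 ≤ k) (x : Fin 2 → Bool) (sched : ℕ → Fin 2) (n : ℕ) :
    Inv k x (run k x sched n) := by
  induction n with
  | zero => exact inv_initC hk x
  | succ n ih => exact ih.step _

lemma pc_done_of_out {k : ℕ} {x : Fin 2 → Bool} {c : Config} (h : Inv k x c) {i : Fin 2} {y : ℚ}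
    (hy : (c.p i).out = some y) : (c.p i).pc = PC.done := by
  by_contra hpc
  simp [(h.loc i).out_none hpc] at hy

lemma step_p_of_done (k : ℕ) (x : Fin 2 → Bool) {c : Config} {i : Fin 2}
    (h : (c.p i).pc = PC.done) (j : Fin 2) : (step k x c j).p i = c.p i := by
  by_cases hij : i = j
  · subst hij
    simp [step, h]
  · simp only [step]
    split <;> (try split_ifs) <;> simp [updP, hij]

/-- The local state of a process does not change once it has decided. -/
lemma run_p_of_done (k : ℕ) (x : Fin 2 → Bool) (sched : ℕ → Fin 2) {i : Fin 2} {m n : ℕ}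
    (hmn : m ≤ n) (h : ((run k x sched m).p i).pc = PC.done) :
    (run k x sched n).p i = (run k x sched m).p i := by
  induction n, hmn using Nat.le_induction with
  | base => rfl
  | succ n _ ih => rw [run, step_p_of_done k x (by rwa [ih]), ih]

lemma decideVal_self (k : ℕ) (a : Bool) (r : ℕ) (new : Bool) :
    decideVal k a (some a) r new = bq a := by
  simp [decideVal]

/-- The value decided after normal termination, in terms of the input of one process. -/
lemma decideVal_completed {k : ℕ} {a b new : Bool} (hab : a ≠ b)
    (hnew : new = decide (k % 2 = 1)) :
    decideVal k a (some b) k new =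
      (bq (if k % 2 = 0 then a else b) + (k : ℚ)) / (2 * (k : ℚ) + 1) := by
  simp [decideVal, hab, hnew]

/-- The value decided after a break, in terms of the input of one process. -/
lemma decideVal_broken {k r : ℕ} {a b new : Bool} (hab : a ≠ b)
    (hnew : new ≠ decide (r % 2 = 1)) :
    decideVal k a (some b) r new =
      bq (if r % 2 = 0 then b else a) +
        ((-1 : ℚ) ^ (if (if r % 2 = 0 then b else a) then 1 else 0) * ((r : ℚ) - 1)) /
          (2 * (k : ℚ) + 1) := by
  have : ¬ (r = k ∧ new = decide (k % 2 = 1)) := by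
    rintro ⟨rfl, h⟩
    exact hnew h
  simp only [decideVal, hab, this, if_false]

lemma abs_sub_le_of_eq_or {y z d : ℚ} (hd : 0 ≤ d) (h : y - z = d ∨ y - z = -d) :
    |y - z| ≤ d := by
  rcases h with h | h <;> simp [h, abs_of_nonneg hd]

lemma completed_completed_close {k : ℕ} {a b u v : Bool} (hab : a ≠ b)
    (hu : u = decide (k % 2 = 1)) (hv : v = decide (k % 2 = 1)) :
    |decideVal k a (some b) k u - decideVal k b (some a) k v| ≤ 1 / (2 * (k : ℚ) + 1) := by
  rw [decideVal_completed hab hu, decideVal_completed hab.symm hv]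
  apply abs_sub_le_of_eq_or (by positivity)
  have hk : (2 * (k : ℚ) + 1) ≠ 0 := by positivity
  split_ifs <;> cases a <;> cases b <;> simp_all [bq] <;> grind

lemma completed_broken_close {k : ℕ} {a b u v : Bool} (hab : a ≠ b)
    (hu : u = decide (k % 2 = 1)) (hv : v ≠ decide (k % 2 = 1)) :
    |decideVal k a (some b) k u - decideVal k b (some a) k v| ≤ 1 / (2 * (k : ℚ) + 1) := by
  rw [decideVal_completed hab hu, decideVal_broken hab.symm hv]
  apply abs_sub_le_of_eq_or (by positivity)
  have hk : (2 * (k : ℚ) + 1) ≠ 0 := by positivity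
  generalize (if k % 2 = 0 then a else b) = w
  cases w <;> simp [bq] <;> grind

lemma broken_broken_close {k r : ℕ} {a b u v : Bool} (hab : a ≠ b)
    (hu : u ≠ decide (r % 2 = 1)) (hv : v ≠ decide ((r + 1) % 2 = 1)) :
    |decideVal k a (some b) r u - decideVal k b (some a) (r + 1) v| ≤ 1 / (2 * (k : ℚ) + 1) := by
  rw [decideVal_broken hab hu, decideVal_broken hab.symm hv]
  apply abs_sub_le_of_eq_or (by positivity)
  have hk : (2 * (k : ℚ) + 1) ≠ 0 := by positivity
  have hw : (if (r + 1) % 2 = 0 then a else b) = if r % 2 = 0 then b else a := by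
    grind
  rw [hw]
  generalize (if r % 2 = 0 then b else a) = w
  cases w <;> simp [bq] <;> grind

/-- Two processes that have decided in a configuration satisfying the invariant have close
outputs. -/
lemma Inv.outputs_close {k : ℕ} {x : Fin 2 → Bool} {c : Config} (h : Inv k x c) {y z : ℚ}
    (hy : (c.p 0).out = some y) (hz : (c.p 1).out = some z) :
    |y - z| ≤ 1 / (2 * (k : ℚ) + 1) := by
  have hy' := pc_done_of_out h hy
  have hz' := pc_done_of_out h hz
  have hs : LocalInv k (x 0) (x 1) (c.p 0) (c.R 0) (c.I 0) := h.loc 0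
  have ht : LocalInv k (x 1) (x 0) (c.p 1) (c.R 1) (c.I 1) := h.loc 1
  have hc : Compatible (c.p 0) (c.p 1) := h.compatible 0
  generalize c.p 0 = s at *
  generalize c.p 1 = t at *
  obtain rfl : _ = y := Option.some.inj ((hs.out_done hy').symm.trans hy)
  obtain rfl : _ = z := Option.some.inj ((ht.out_done hz').symm.trans hz)
  by_cases hab : x 0 = x 1
  · rw [hab, decideVal_self, decideVal_self, sub_self, abs_zero]
    positivity
  have hsl : s.Left := .inr (.inr hy')
  have htl : t.Left := .inr (.inr hz')
  have hsw : s.writes = s.r := by simp [PState.writes, hy']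
  have htw : t.writes = t.r := by simp [PState.writes, hz']
  rcases hc with ⟨hw, hb⟩ | hA | hA
  · rw [hsw, htw] at hw
    by_cases hu : s.new = decide (s.r % 2 = 1)
    · have hsk := hs.completed ⟨hsl, hu⟩
      rw [← hw, hsk]
      rw [hsk] at hu
      by_cases hv : t.new = decide (k % 2 = 1)
      · exact completed_completed_close hab hu hv
      · exact completed_broken_close hab hu hv
    · have hv : t.new = decide (t.r % 2 = 1) := by
        by_contra hv
        exact hb ⟨⟨hsl, hu⟩, ⟨htl, hv⟩⟩
      have htk := ht.completed ⟨htl, hv⟩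
      rw [hw, htk] at hu ⊢
      rw [htk] at hv
      rw [abs_sub_comm]
      exact completed_broken_close (Ne.symm hab) hv hu
  · have hw := hA.writes
    have hu : s.new ≠ decide (s.r % 2 = 1) := fun hu => hA.not_completed ⟨hsl, hu⟩
    have hv := (hA.pending.resolve_left (by simp [hz'])).2
    rw [hsw, htw] at hw
    rw [hw] at hv ⊢
    exact broken_broken_close hab hu hv
  · have hw := hA.writes
    have hu : t.new ≠ decide (t.r % 2 = 1) := fun hu => hA.not_completed ⟨htl, hu⟩
    have hv := (hA.pending.resolve_left (by simp [hy'])).2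
    rw [hsw, htw] at hw
    rw [hw] at hv ⊢
    rw [abs_sub_comm]
    exact broken_broken_close (Ne.symm hab) hu hv

end AlgoAk

open AlgoAk in
/-- Lemma 12: in every execution of `A_k` in which both processes decide, their
outputs satisfy `|y₁ − y₂| ≤ 1/(2k+1)`. -/
theorem outputs_close (k : ℕ) (hk : 1 ≤ k) (x : Fin 2 → Bool)
    (sched : ℕ → Fin 2) (n₁ n₂ : ℕ) (y₁ y₂ : ℚ)
    (h1 : ((run k x sched n₁).p 0).out = some y₁)
    (h2 : ((run k x sched n₂).p 1).out = some y₂) :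
    |y₁ - y₂| ≤ 1 / (2 * (k : ℚ) + 1) := by
  have hy := run_p_of_done k x sched (le_max_left n₁ n₂) (pc_done_of_out (inv_run hk x sched n₁) h1)
  have hz := run_p_of_done k x sched (le_max_right n₁ n₂) (pc_done_of_out (inv_run hk x sched n₂) h2)
  exact (inv_run hk x sched (max n₁ n₂)).outputs_close (by rw [hy, h1]) (by rw [hz, h2])
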